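/- Fix a real number p > 2 and an integer n ≥ 1, and let φ_n be as defined in the context. Then the second derivative of φ_n satisfies φ_n''(r) ≤ p(p-1)·|r|^{p-2} for every r ∈ ℝ. -/

import Mathlib

/-- The truncated power function `φ_n`: `φ_n(r) = |r|^p` for `|r| < n`, and the second-order
Taylor extension `n^{p-2} (p(p-1)/2)(|r|-n)² + p n^{p-1}(|r|-n) + n^p` for `|r| ≥ n`. -/
noncomputable def phi (p : ℝ) (n : ℕ) (r : ℝ) : ℝ :=
  if |r| < n then |r| ^ p
  else (n : ℝ) ^ (p - 2) * (p * (p - 1) / 2) * (|r| - n) ^ 2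
      + p * (n : ℝ) ^ (p - 1) * (|r| - n) + (n : ℝ) ^ p

/-- Two functions that agree to first order at `a` can be interleaved near `a` without changing
the derivative there. -/
theorem HasDerivAt.of_eventually_eq_or_eq {f g h : ℝ → ℝ} {c a : ℝ} (hf : HasDerivAt f c a)
    (hg : HasDerivAt g c a) (hfa : h a = f a) (hga : h a = g a)
    (hh : ∀ᶠ x in nhds a, h x = f x ∨ h x = g x) : HasDerivAt h c a := by
  rw [hasDerivAt_iff_isLittleO, Asymptotics.isLittleO_iff] at *
  intro ε hε
  filter_upwards [hf hε, hg hε, hh] with x h₁ h₂ h₃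
  rcases h₃ with h₃ | h₃
  · rwa [h₃, hfa]
  · rwa [h₃, hga]

theorem HasDerivAt.ite_abs_lt {f g f' g' : ℝ → ℝ} {b : ℝ} (hb : 0 < b)
    (hf : ∀ x, HasDerivAt f (f' x) x) (hg : ∀ x, x ≠ 0 → HasDerivAt g (g' x) x)
    (hfg : ∀ x, |x| = b → f x = g x) (hfg' : ∀ x, |x| = b → f' x = g' x) (x : ℝ) :
    HasDerivAt (fun y => if |y| < b then f y else g y) (if |x| < b then f' x else g' x) x := by
  rcases lt_trichotomy |x| b with h | h | h
  · rw [if_pos h]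
    refine (hf x).congr_of_eventuallyEq ?_
    filter_upwards [continuous_abs.continuousAt.eventually_lt_const h] with y hy
    exact if_pos hy
  · have hx : x ≠ 0 := abs_pos.1 (h ▸ hb)
    rw [if_neg h.not_lt]
    refine (hfg' x h ▸ hf x).of_eventually_eq_or_eq (hg x hx) ?_ ?_ (.of_forall fun y => ?_)
    · simp [h, hfg x h]
    · simp [h]
    · exact (em (|y| < b)).imp (fun hy => if_pos hy) fun hy => if_neg hy
  · rw [if_neg h.not_gt]
    refine (hg x (abs_pos.1 (hb.trans h))).congr_of_eventuallyEq ?_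
    filter_upwards [continuous_abs.continuousAt.eventually_const_lt h] with y hy
    exact if_neg hy.not_gt

theorem hasDerivAt_sign_of_ne_zero {x : ℝ} (hx : x ≠ 0) :
    HasDerivAt (fun y : ℝ => (SignType.sign y : ℝ)) 0 x := by
  rcases hx.lt_or_gt with h | h
  · refine (hasDerivAt_const x (-1 : ℝ)).congr_of_eventuallyEq ?_
    filter_upwards [eventually_lt_nhds h] with y hy
    simp [sign_neg hy]
  · refine (hasDerivAt_const x (1 : ℝ)).congr_of_eventuallyEq ?_
    filter_upwards [eventually_gt_nhds h] with y hy
    simp [sign_pos hy]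

theorem hasDerivAt_abs_rpow_mul_self {s : ℝ} (hs : 0 < s) (x : ℝ) :
    HasDerivAt (fun y : ℝ => |y| ^ s * y) ((s + 1) * |x| ^ s) x := by
  rcases eq_or_ne x 0 with rfl | hx
  · have hc : Filter.Tendsto (fun y : ℝ => |y| ^ s) (nhds 0) (nhds 0) := by
      have : Continuous fun y : ℝ => |y| ^ s := continuous_abs.rpow_const fun _ => .inr hs.le
      simpa [Real.zero_rpow hs.ne'] using this.tendsto 0
    rw [hasDerivAt_iff_isLittleO]
    simpa [Real.zero_rpow hs.ne'] using
      ((Asymptotics.isLittleO_one_iff ℝ).2 hc).mul_isBigO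
        (Asymptotics.isBigO_refl (fun y : ℝ => y) (nhds 0))
  · have hx' : |x| ≠ 0 := abs_ne_zero.2 hx
    refine (((hasDerivAt_abs hx).rpow_const (p := s) (.inl hx')).mul
      (hasDerivAt_id x)).congr_deriv ?_
    have hsx : (SignType.sign x : ℝ) * x = |x| := sign_mul_self x
    rw [Real.rpow_sub_one hx']
    simp only [id]
    field_simp
    linear_combination s * hsx

/-- For `p > 2` and `n ≥ 1`, `φ_n''(r) ≤ p(p-1) |r|^{p-2}` for every `r ∈ ℝ`. -/
theorem statement7 (p : ℝ) (hp : 2 < p) (n : ℕ) (hn : 1 ≤ n) (r : ℝ) :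
    deriv (deriv (phi p n)) r ≤ p * (p - 1) * |r| ^ (p - 2) := by
  have hn₀ : (0 : ℝ) < n := by exact_mod_cast hn
  have hpow : (n : ℝ) ^ (p - 1) = (n : ℝ) ^ (p - 2) * n := by
    rw [← Real.rpow_add_one hn₀.ne']
    ring_nf
  have h₁ : deriv (phi p n) = fun x : ℝ => if |x| < n then p * (|x| ^ (p - 2) * x)
      else (n : ℝ) ^ (p - 2) * p * ((p - 1) * x + (2 - p) * n * (SignType.sign x : ℝ)) := by
    funext x
    refine (HasDerivAt.ite_abs_lt (f := fun x => |x| ^ p)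
      (g := fun x => (n : ℝ) ^ (p - 2) * (p * (p - 1) / 2) * (|x| - n) ^ 2
        + p * (n : ℝ) ^ (p - 1) * (|x| - n) + (n : ℝ) ^ p)
      (f' := fun x => p * (|x| ^ (p - 2) * x))
      (g' := fun x => (n : ℝ) ^ (p - 2) * p *
        ((p - 1) * x + (2 - p) * n * (SignType.sign x : ℝ))) hn₀
      (fun x => (hasDerivAt_abs_rpow x (by linarith : 1 < p)).congr_deriv (mul_assoc _ _ _))
      (fun x hx => ?_) (fun x hx => ?_) (fun x hx => ?_) x).deriv
    · have ha := (hasDerivAt_abs hx).sub_const (n : ℝ)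
      refine ((((ha.pow 2).const_mul _).add (ha.const_mul _)).add_const _).congr_deriv ?_
      have hsx : (SignType.sign x : ℝ) * |x| = x := sign_mul_abs x
      rw [hpow]
      push_cast
      linear_combination (n : ℝ) ^ (p - 2) * p * (p - 1) * hsx
    · simp [hx]
    · have hsx : (SignType.sign x : ℝ) * |x| = x := sign_mul_abs x
      rw [hx] at hsx ⊢
      linear_combination (n : ℝ) ^ (p - 2) * p * (p - 2) * hsx
  have h₂ : deriv (deriv (phi p n)) r = if |r| < n then p * (p - 1) * |r| ^ (p - 2)
      else p * (p - 1) * (n : ℝ) ^ (p - 2) := by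
    rw [h₁]
    refine (HasDerivAt.ite_abs_lt (f' := fun x => p * (p - 1) * |x| ^ (p - 2))
      (g' := fun _ => p * (p - 1) * (n : ℝ) ^ (p - 2)) hn₀
      (fun x => ?_) (fun x hx => ?_) (fun x hx => ?_) (fun x hx => by rw [hx]) r).deriv
    · refine ((hasDerivAt_abs_rpow_mul_self (sub_pos.2 hp) x).const_mul p).congr_deriv ?_
      ring
    · refine ((((hasDerivAt_id x).const_mul _).add
        ((hasDerivAt_sign_of_ne_zero hx).const_mul _)).const_mul _).congr_deriv ?_
      ring
    · have hsx : (SignType.sign x : ℝ) * |x| = x := sign_mul_abs x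
      rw [hx] at hsx ⊢
      linear_combination (n : ℝ) ^ (p - 2) * p * (2 - p) * -hsx
  rw [h₂]
  split_ifs with h
  · rfl
  · have hc : 0 ≤ p * (p - 1) := mul_nonneg (by linarith) (by linarith)
    gcongr
    exact not_lt.1 h
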